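/- arXiv:2008.10722 — 2 statements merged into one kernel-verified Lean document; each statement's English description precedes it below -/
import Mathlib

section
/- Let Ω ⊂ ℝ² be a bounded open set satisfying the uniform interior cone condition with radius δ > 0 and aperture γ > 0. Let M > 0, q > 0 and α ∈ (0,1] with qα ≥ 2, and suppose J : Ω → (0, ∞) is measurable, satisfies J(x) ≤ J(y) + M|x − y|^α for all x, y ∈ Ω, and ∫_Ω J(x)^{−q} dx ≤ C* < ∞. Then, with h(t) := ∫₀^δ (t + M r^α)^{−q} r dr, one has J(y) ≥ h^{−1}(C*/γ) > 0 for every y ∈ Ω; in particular, inf_Ω J > 0. -/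
open MeasureTheory

/-- The open circular sector with vertex `y`, radius `δ` and angular set `I`. -/
def circularSector (y : EuclideanSpace ℝ (Fin 2)) (δ : ℝ) (I : Set ℝ) :
    Set (EuclideanSpace ℝ (Fin 2)) :=
  {x | ∃ r ∈ Set.Ioo 0 δ, ∃ θ ∈ I,
    x = y + r • (EuclideanSpace.equiv (Fin 2) ℝ).symm ![Real.cos θ, Real.sin θ]}

/-- `Ω` satisfies the uniform interior cone condition with radius `δ` and aperture `γ`:
every `y ∈ Ω` is the vertex of an open circular sector of radius `δ` and angular measure `γ`
contained in `Ω`. -/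
def UniformInteriorCone (Ω : Set (EuclideanSpace ℝ (Fin 2))) (δ γ : ℝ) : Prop :=
  ∀ y ∈ Ω, ∃ I : Set ℝ, MeasurableSet I ∧ I ⊆ Set.Ioo 0 (2 * Real.pi) ∧
    volume I = ENNReal.ofReal γ ∧ circularSector y δ I ⊆ Ω


noncomputable def FF (M q α t r : ℝ) : ℝ := (t + M * r ^ α) ^ (-q) * r

lemma FF_cont (M q α t : ℝ) (hM : 0 < M) (hα : 0 < α) (ht : 0 < t) :
    ContinuousOn (FF M q α t) (Set.Ici 0) := by
  unfold FF
  apply ContinuousOn.mul _ continuousOn_id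
  apply ContinuousOn.rpow_const
  · exact continuousOn_const.add (continuousOn_const.mul
      (continuousOn_id.rpow_const (fun x hx => Or.inr hα.le)))
  · intro r hr
    left
    have : 0 ≤ r ^ α := Real.rpow_nonneg hr _
    positivity

lemma FF_le (M q α δ t s r : ℝ) (hM : 0 < M) (hq : 0 < q) (hs : 0 < s) (hst : s ≤ t)
    (hr : r ∈ Set.Ioo 0 δ) : FF M q α t r ≤ s ^ (-q) * δ := by
  unfold FF
  have hr0 : 0 < r := hr.1
  have : 0 ≤ r ^ α := Real.rpow_nonneg hr0.le _
  have h1 : s ≤ t + M * r ^ α := by nlinarith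
  apply mul_le_mul _ hr.2.le hr0.le (by positivity)
  exact Real.rpow_le_rpow_of_nonpos hs h1 (by linarith)

lemma FF_pos (M q α t r : ℝ) (hM : 0 < M) (ht : 0 < t) (hr : 0 < r) : 0 < FF M q α t r := by
  unfold FF; positivity

lemma FF_int (M q α δ t : ℝ) (hM : 0 < M) (hα : 0 < α) (ht : 0 < t) :
    IntegrableOn (FF M q α t) (Set.Ioo 0 δ) := by
  apply IntegrableOn.mono_set (t := Set.Icc 0 δ) _ Set.Ioo_subset_Icc_self
  apply ContinuousOn.integrableOn_Icc
  exact (FF_cont M q α t hM hα ht).mono (fun x hx => hx.1)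

lemma h_anti (M q α δ t s : ℝ) (hM : 0 < M) (hα : 0 < α) (hq : 0 < q) (hδ : 0 < δ)
    (hs : 0 < s) (hst : s < t) :
    ∫ r in Set.Ioo 0 δ, FF M q α t r < ∫ r in Set.Ioo 0 δ, FF M q α s r := by
  have ht := hs.trans hst
  have i1 := FF_int M q α δ t hM hα ht
  have i2 := FF_int M q α δ s hM hα hs
  rw [← sub_pos, ← integral_sub i2 i1, ← integral_Ioc_eq_integral_Ioo,
    ← intervalIntegral.integral_of_le hδ.le]
  apply intervalIntegral.intervalIntegral_pos_of_pos_on _ _ hδ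
  · rw [intervalIntegrable_iff_integrableOn_Ioo_of_le hδ.le]
    exact i2.sub i1
  · intro r hr
    have hr0 : 0 < r := hr.1
    rw [sub_pos]
    unfold FF
    apply mul_lt_mul_of_pos_right _ hr0
    exact Real.rpow_lt_rpow_of_neg (by positivity) (by linarith) (by linarith)

lemma h_cont (M q α δ : ℝ) (hM : 0 < M) (hα : 0 < α) (hq : 0 < q) :
    ContinuousOn (fun t => ∫ r in Set.Ioo 0 δ, FF M q α t r) (Set.Ioi 0) := by
  intro t0 ht0
  have ht0 : 0 < t0 := ht0
  apply ContinuousAt.continuousWithinAt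
  have hn : ∀ᶠ t in nhds t0, t0 / 2 < t := lt_mem_nhds (by linarith)
  apply continuousAt_of_dominated (bound := fun _ => (t0/2) ^ (-q) * δ)
  · filter_upwards [hn] with t ht
    exact (FF_int M q α δ t hM hα (by linarith)).aestronglyMeasurable
  · filter_upwards [hn] with t ht
    filter_upwards [ae_restrict_mem measurableSet_Ioo] with r hr
    rw [Real.norm_of_nonneg (FF_pos M q α t r hM (by linarith) hr.1).le]
    exact FF_le M q α δ t _ r hM hq (by linarith) ht.le hr
  · exact integrable_const _
  · filter_upwards [ae_restrict_mem measurableSet_Ioo] with r hr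
    have hr0 : 0 < r := hr.1
    unfold FF
    apply ContinuousAt.mul _ continuousAt_const
    apply ContinuousAt.rpow_const (by fun_prop)
    left
    positivity

lemma h_small (M q α δ K : ℝ) (hM : 0 < M) (hα : 0 < α) (hq : 0 < q) (hδ : 0 < δ) (hK : 0 < K) :
    ∃ t, 0 < t ∧ ∫ r in Set.Ioo 0 δ, FF M q α t r ≤ K := by
  refine ⟨(K / δ ^ 2) ^ (- q⁻¹), by positivity, ?_⟩
  set t := (K / δ ^ 2) ^ (- q⁻¹) with htd
  have ht : 0 < t := by positivity
  have : ∫ r in Set.Ioo 0 δ, FF M q α t r ≤ ∫ r in Set.Ioo 0 δ, t ^ (-q) * δ := by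
    apply setIntegral_mono_on (FF_int M q α δ t hM hα ht) (integrable_const _) measurableSet_Ioo
    intro r hr
    exact FF_le M q α δ t _ r hM hq ht le_rfl hr
  refine this.trans ?_
  have e : t ^ (-q) = K / δ ^ 2 := by
    rw [htd, ← Real.rpow_mul (by positivity)]
    have : -q⁻¹ * -q = 1 := by field_simp
    rw [this, Real.rpow_one]
  rw [e]
  simp [Measure.real, hδ.le]
  field_simp
  rfl

lemma h_large (M q α δ K : ℝ) (hM : 0 < M) (hα : 0 < α) (hq : 0 < q) (hδ : 0 < δ)
    (hqα : 2 ≤ q * α) (hK : 0 < K) :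
    ∃ t, 0 < t ∧ K ≤ ∫ r in Set.Ioo 0 δ, FF M q α t r := by
  set c := (2 * M) ^ (-q) * δ ^ (2 - q * α) with hc
  have hc0 : 0 < c := by positivity
  set ε := δ * Real.exp (-(K / c)) with hε
  have hε0 : 0 < ε := by positivity
  have hεδ : ε < δ := by
    have : Real.exp (-(K / c)) < 1 := by
      rw [Real.exp_lt_one_iff]; have : 0 < K / c := by positivity
      linarith
    nlinarith
  have ht : 0 < M * ε ^ α := by positivity
  refine ⟨M * ε ^ α, ht, ?_⟩
  set t := M * ε ^ α with htd
  have i := FF_int M q α δ t hM hα ht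
  have hsub : Set.Ioo ε δ ⊆ Set.Ioo 0 δ := Set.Ioo_subset_Ioo_left hε0.le
  have h1 : ∫ r in Set.Ioo ε δ, FF M q α t r ≤ ∫ r in Set.Ioo 0 δ, FF M q α t r := by
    apply setIntegral_mono_set i
    · filter_upwards [ae_restrict_mem measurableSet_Ioo] with r hr
      exact (FF_pos M q α t r hM ht hr.1).le
    · exact hsub.eventuallyLE
  refine le_trans ?_ h1
  have h2 : ∫ r in Set.Ioo ε δ, c * r⁻¹ = K := by
    rw [integral_const_mul, ← integral_Ioc_eq_integral_Ioo,
      ← intervalIntegral.integral_of_le hεδ.le, integral_inv_of_pos hε0 hδ, hε,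
      Real.log_div hδ.ne' (by positivity), Real.log_mul hδ.ne' (Real.exp_pos _).ne', Real.log_exp]
    field_simp
    ring
  rw [← h2]
  apply setIntegral_mono_on _ (i.mono_set hsub) measurableSet_Ioo
  · intro r hr
    have hr0 : 0 < r := hε0.trans hr.1
    have hrδ : r / δ < 1 := by rw [div_lt_one hδ]; exact hr.2
    unfold FF
    have a1 : t + M * r ^ α ≤ (2 * M) * r ^ α := by
      have : ε ^ α ≤ r ^ α := Real.rpow_le_rpow hε0.le hr.1.le hα.le
      rw [htd]; nlinarith
    have a2 : ((2 * M) * r ^ α) ^ (-q) ≤ (t + M * r ^ α) ^ (-q) :=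
      Real.rpow_le_rpow_of_nonpos (by positivity) a1 (by linarith)
    have a3 : ((2 * M) * r ^ α) ^ (-q) = (2 * M) ^ (-q) * (r ^ (2 - q * α) * (r ^ (2:ℝ))⁻¹) := by
      rw [Real.mul_rpow (by positivity) (by positivity), ← Real.rpow_mul hr0.le,
        ← Real.rpow_neg hr0.le, ← Real.rpow_add hr0]
      congr 2; ring
    have a4 : δ ^ (2 - q * α) ≤ r ^ (2 - q * α) :=
      Real.rpow_le_rpow_of_nonpos hr0 hr.2.le (by linarith)
    calc c * r⁻¹ = (2 * M) ^ (-q) * (δ ^ (2 - q * α) * (r ^ (2:ℝ))⁻¹) * r := by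
          rw [hc, Real.rpow_two]; field_simp
      _ ≤ (2 * M) ^ (-q) * (r ^ (2 - q * α) * (r ^ (2:ℝ))⁻¹) * r := by gcongr
      _ ≤ _ := by rw [← a3]; gcongr
  · apply IntegrableOn.mono_set (t := Set.Icc ε δ) _ Set.Ioo_subset_Icc_self
    apply ContinuousOn.integrableOn_Icc
    apply continuousOn_const.mul
    apply continuousOn_inv₀.mono
    intro x hx
    exact (hε0.trans_le hx.1).ne'

lemma h_surj (M q α δ K : ℝ) (hM : 0 < M) (hα : 0 < α) (hq : 0 < q) (hδ : 0 < δ)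
    (hqα : 2 ≤ q * α) (hK : 0 < K) :
    ∃ t, 0 < t ∧ ∫ r in Set.Ioo 0 δ, FF M q α t r = K := by
  obtain ⟨a, ha, hak⟩ := h_small M q α δ K hM hα hq hδ hK
  obtain ⟨b, hb, hbk⟩ := h_large M q α δ K hM hα hq hδ hqα hK
  exact isPreconnected_Ioi.intermediate_value (Set.mem_Ioi.2 ha) (Set.mem_Ioi.2 hb)
    (h_cont M q α δ hM hα hq) ⟨hak, hbk⟩

lemma sector_bound (Ω : Set (EuclideanSpace ℝ (Fin 2))) (hΩ : MeasurableSet Ω)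
    (y : EuclideanSpace ℝ (Fin 2)) (δ : ℝ) (I : Set ℝ) (hI : MeasurableSet I)
    (hI2 : I ⊆ Set.Ioo 0 (2 * Real.pi)) (hsec : circularSector y δ I ⊆ Ω)
    (g : ℝ → ENNReal) (hg : Measurable g) :
    (∫⁻ r in Set.Ioo 0 δ, ENNReal.ofReal r * g r) * volume I ≤ ∫⁻ x in Ω, g ‖x - y‖ := by
  have e1 : ∫⁻ x in Ω, g ‖x - y‖ = ∫⁻ x, Ω.indicator (fun x => g ‖x - y‖) x :=
    (lintegral_indicator hΩ _).symm
  set f : EuclideanSpace ℝ (Fin 2) → ENNReal := Ω.indicator (fun x => g ‖x - y‖) with hf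
  have hfm : Measurable f := Measurable.indicator (by fun_prop) hΩ
  have e2 : ∫⁻ x, f x = ∫⁻ z, f (y - z) := (lintegral_sub_left_eq_self f y).symm
  have mp : MeasurePreserving Complex.orthonormalBasisOneI.repr :=
    Complex.orthonormalBasisOneI.repr.measurePreserving
  have e3 : ∫⁻ z, f (y - z) = ∫⁻ z : ℂ, f (y - Complex.orthonormalBasisOneI.repr z) :=
    (mp.lintegral_comp (f := fun z => f (y - z)) (by fun_prop)).symm
  rw [e1, e2, e3, ← Complex.lintegral_comp_polarCoord_symm]
  set I' : Set ℝ := (fun θ => θ + Real.pi) ⁻¹' I with hI'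
  have hI'm : MeasurableSet I' := hI.preimage (by fun_prop)
  have hvol : volume I' = volume I := by
    rw [hI', measure_preimage_add_right]
  have hsub : Set.Ioo 0 δ ×ˢ I' ⊆ polarCoord.target := by
    rintro ⟨r, θ⟩ ⟨hr, hθ⟩
    have := hI2 hθ
    simp only [polarCoord_target, Set.mem_prod, Set.mem_Ioi, Set.mem_Ioo] at this hr ⊢
    exact ⟨hr.1, by linarith, by linarith⟩
  have e4 : (∫⁻ r in Set.Ioo 0 δ, ENNReal.ofReal r * g r) * volume I
      = ∫⁻ p in Set.Ioo 0 δ ×ˢ I', ENNReal.ofReal p.1 * g p.1 := by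
    rw [Measure.volume_eq_prod, setLIntegral_prod _ (by fun_prop)]
    simp only [lintegral_const, Measure.restrict_apply MeasurableSet.univ, Set.univ_inter, hvol]
    rw [lintegral_mul_const _ (by fun_prop)]
  rw [e4]
  refine le_trans ?_ (lintegral_mono_set hsub)
  apply setLIntegral_mono' (measurableSet_Ioo.prod hI'm)
  rintro ⟨r, θ⟩ ⟨hr, hθ⟩
  have hr : r ∈ Set.Ioo 0 δ := hr
  have hθ : θ + Real.pi ∈ I := hθ
  rw [smul_eq_mul]
  apply mul_le_mul_right
  set z := Complex.polarCoord.symm (r, θ) with hz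
  have hmem : y - Complex.orthonormalBasisOneI.repr z ∈ Ω := by
    apply hsec
    refine ⟨r, hr, θ + Real.pi, hθ, ?_⟩
    rw [hz, Complex.polarCoord_symm_apply]
    ext i
    fin_cases i <;> simp [EuclideanSpace.equiv, Complex.orthonormalBasisOneI_repr_apply, Complex.cos_ofReal_re,
      Complex.sin_ofReal_re, -Complex.ofReal_cos, -Complex.ofReal_sin] <;> ring
  rw [hf, Set.indicator_of_mem hmem]
  have : ‖y - Complex.orthonormalBasisOneI.repr z - y‖ = r := by
    rw [sub_sub_cancel_left, norm_neg, LinearIsometryEquiv.norm_map, hz,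
      Complex.norm_polarCoord_symm, abs_of_pos hr.1]
  rw [this]

/-- interior estimate (3.9)–(3.10) in the proof of the paper's Lemma 3.3:
under the uniform interior cone condition, the one-sided Hölder bound and the integral
bound `∫_Ω J^{-q} ≤ C*`, the field `J` is bounded below on `Ω` by `h⁻¹(C*/γ) > 0`, where
`h(t) = ∫₀^δ (t + M r^α)^{-q} r dr`. -/
theorem interior_lower_bound_of_integral_bound
    (Ω : Set (EuclideanSpace ℝ (Fin 2))) (hΩopen : IsOpen Ω)
    (hΩbdd : Bornology.IsBounded Ω)
    (δ γ M q α Cstar : ℝ) (hδ : 0 < δ) (hγ : 0 < γ)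
    (hcone : UniformInteriorCone Ω δ γ)
    (hM : 0 < M) (hq : 0 < q) (hα : α ∈ Set.Ioc (0 : ℝ) 1) (hqα : 2 ≤ q * α)
    (J : EuclideanSpace ℝ (Fin 2) → ℝ)
    (hJmeas : AEMeasurable J (volume.restrict Ω))
    (hJpos : ∀ x ∈ Ω, 0 < J x)
    (hHolder : ∀ x ∈ Ω, ∀ y ∈ Ω, J x ≤ J y + M * ‖x - y‖ ^ α)
    (hCpos : 0 < Cstar)
    (hint : ∫⁻ x in Ω, ENNReal.ofReal (J x ^ (-q)) ≤ ENNReal.ofReal Cstar)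
    (h : ℝ → ℝ)
    (hdef : ∀ t, h t = ∫ r in Set.Ioo 0 δ, (t + M * r ^ α) ^ (-q) * r) :
    0 < Function.invFunOn h (Set.Ioi 0) (Cstar / γ) ∧
    ∀ y ∈ Ω, Function.invFunOn h (Set.Ioi 0) (Cstar / γ) ≤ J y := by
  have hα0 : 0 < α := hα.1
  have hF : ∀ t, h t = ∫ r in Set.Ioo 0 δ, FF M q α t r := hdef
  have hK : 0 < Cstar / γ := by positivity
  have hex : ∃ t ∈ Set.Ioi (0:ℝ), h t = Cstar / γ := by
    obtain ⟨t, ht, e⟩ := h_surj M q α δ (Cstar / γ) hM hα0 hq hδ hqα hK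
    exact ⟨t, ht, by rw [hF, e]⟩
  obtain ⟨ht0, hte⟩ := Function.invFunOn_pos hex
  refine ⟨ht0, ?_⟩
  intro y hy
  set t := Function.invFunOn h (Set.Ioi 0) (Cstar / γ) with htd
  have hJy := hJpos y hy
  by_contra hlt
  push Not at hlt
  have hanti := h_anti M q α δ t (J y) hM hα0 hq hδ hJy hlt
  rw [← hF, ← hF, hte] at hanti
  obtain ⟨I, hI, hI2, hIv, hsec⟩ := hcone y hy
  have hb := sector_bound Ω hΩopen.measurableSet y δ I hI hI2 hsec
    (fun r => ENNReal.ofReal ((J y + M * r ^ α) ^ (-q))) (by fun_prop)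
  have hb2 : ∫⁻ x in Ω, ENNReal.ofReal ((J y + M * ‖x - y‖ ^ α) ^ (-q))
      ≤ ENNReal.ofReal Cstar := by
    refine le_trans (setLIntegral_mono' hΩopen.measurableSet ?_) hint
    intro x hx
    apply ENNReal.ofReal_le_ofReal
    exact Real.rpow_le_rpow_of_nonpos (hJpos x hx) (hHolder x hx y hy) (by linarith)
  have e : ∫⁻ r in Set.Ioo 0 δ, ENNReal.ofReal r * ENNReal.ofReal ((J y + M * r ^ α) ^ (-q))
      = ENNReal.ofReal (h (J y)) := by
    rw [hF, ofReal_integral_eq_lintegral_ofReal (FF_int M q α δ (J y) hM hα0 hJy)]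
    · apply setLIntegral_congr_fun measurableSet_Ioo
      intro r hr
      simp only [FF]
      rw [← ENNReal.ofReal_mul hr.1.le, mul_comm]
    · filter_upwards [ae_restrict_mem measurableSet_Ioo] with r hr
      exact (FF_pos M q α (J y) r hM hJy hr.1).le
  have hb3 := hb.trans hb2
  rw [e, hIv, ← ENNReal.ofReal_mul' hγ.le, ENNReal.ofReal_le_ofReal_iff hCpos.le] at hb3
  rw [div_lt_iff₀ hγ] at hanti
  linarith
end

section
/- Let Ω ⊂ ℝ² be a bounded open set and p > 2. Let w_k, w : ℝ² → ℝ² be twice continuously differentiable functions such that sup_k ∫_Ω ‖Dw_k(x)‖^p dx < ∞ and w_k → w uniformly on Ω. Then for every continuously differentiable φ : Ω → ℝ with compact support in Ω, ∫_Ω det(Dw_k(x)) φ(x) dx → ∫_Ω det(Dw(x)) φ(x) dx as k → ∞. -/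
open MeasureTheory

local notation "E2" => EuclideanSpace ℝ (Fin 2)

noncomputable def jdet (a b : E2) (f g : E2 → ℝ) (x : E2) : ℝ :=
  fderiv ℝ f x a * fderiv ℝ g x b - fderiv ℝ f x b * fderiv ℝ g x a

lemma jdet_cont (a b : E2) {f g : E2 → ℝ} (hf : ContDiff ℝ 1 f) (hg : ContDiff ℝ 1 g) :
    Continuous (jdet a b f g) := by
  have h1 := hf.continuous_fderiv (by norm_num)
  have h2 := hg.continuous_fderiv (by norm_num)
  unfold jdet
  fun_prop

lemma parts_aux (a : E2) (f ψ : E2 → ℝ) (hf : ContDiff ℝ 1 f) (hψ : ContDiff ℝ 1 ψ)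
    (hc : HasCompactSupport ψ) :
    ∫ x, fderiv ℝ f x a * ψ x = - ∫ x, f x * fderiv ℝ ψ x a := by
  have h1 := hf.continuous_fderiv (by norm_num)
  have h2 := hψ.continuous_fderiv (by norm_num)
  have h3 := hf.continuous
  have h4 := hψ.continuous
  have hc' : HasCompactSupport (fun x => fderiv ℝ ψ x a) := hc.fderiv_apply ℝ a
  have := integral_mul_fderiv_eq_neg_fderiv_mul_of_integrable (μ := volume) (f := f) (g := ψ) (v := a)
    (Continuous.integrable_of_hasCompactSupport (by fun_prop) hc.mul_left)
    (Continuous.integrable_of_hasCompactSupport (by fun_prop) hc'.mul_left)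
    (Continuous.integrable_of_hasCompactSupport (by fun_prop) hc.mul_left)
    (fun x _ => (hf.differentiable (by norm_num)) x) (fun x _ => (hψ.differentiable (by norm_num)) x)
  linarith

lemma jac_parts (a b : E2) (f g φ : E2 → ℝ) (hf : ContDiff ℝ 2 f) (hg : ContDiff ℝ 2 g)
    (hφ : ContDiff ℝ 1 φ) (hc : HasCompactSupport φ) :
    ∫ x, jdet a b f g x * φ x = - ∫ x, f x * jdet a b φ g x := by
  have hf1 : ContDiff ℝ 1 f := hf.of_le (by norm_num)
  have hg1 : ContDiff ℝ 1 g := hg.of_le (by norm_num)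
  have hDg : ContDiff ℝ 1 (fderiv ℝ g) := hg.fderiv_right (by norm_num)
  have hga : ∀ c, ContDiff ℝ 1 (fun x => fderiv ℝ g x c) := fun c => by fun_prop
  have hψ : ∀ c, ContDiff ℝ 1 (fun x => fderiv ℝ g x c * φ x) := fun c => (hga c).mul hφ
  have hψc : ∀ c, HasCompactSupport (fun x => fderiv ℝ g x c * φ x) := fun c => hc.mul_left
  have hfc := hf1.continuous_fderiv (by norm_num)
  have hf0 := hf.continuous
  have hd : ∀ c d x, fderiv ℝ (fun x => fderiv ℝ g x c * φ x) x d
      = fderiv ℝ g x c * fderiv ℝ φ x d + φ x * fderiv ℝ (fderiv ℝ g) x d c := by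
    intro c d x
    have hA : DifferentiableAt ℝ (fderiv ℝ g) x := hDg.differentiable (by norm_num) x
    rw [fderiv_fun_mul ((hga c).differentiable (by norm_num) x) (hφ.differentiable (by norm_num) x)]
    have : fderiv ℝ (fun x => fderiv ℝ g x c) x d = fderiv ℝ (fderiv ℝ g) x d c := by
      rw [fderiv_clm_apply hA (differentiableAt_const c)]
      simp
    simp [this]
  have key : ∀ c d, Integrable (fun x => fderiv ℝ f x c * (fderiv ℝ g x d * φ x)) := fun c d =>
    Continuous.integrable_of_hasCompactSupport
      (by have := (hψ d).continuous; fun_prop) (hψc d).mul_left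
  have key2 : ∀ c d, Integrable (fun x => f x * fderiv ℝ (fun x => fderiv ℝ g x d * φ x) x c) :=
    fun c d => by
      have h' : HasCompactSupport (fun x => fderiv ℝ (fun x => fderiv ℝ g x d * φ x) x c) :=
        (hψc d).fderiv_apply ℝ c
      have := (hψ d).continuous_fderiv (by norm_num)
      exact Continuous.integrable_of_hasCompactSupport (by fun_prop) h'.mul_left
  have e1 : ∫ x, jdet a b f g x * φ x = (∫ x, fderiv ℝ f x a * (fderiv ℝ g x b * φ x))
      - ∫ x, fderiv ℝ f x b * (fderiv ℝ g x a * φ x) := by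
    rw [← integral_sub (key a b) (key b a)]
    congr 1; ext x; simp only [jdet]; ring
  rw [e1, parts_aux a f _ hf1 (hψ b) (hψc b), parts_aux b f _ hf1 (hψ a) (hψc a),
    ← neg_sub_neg, neg_neg, neg_neg, ← neg_sub, ← integral_sub (key2 a b) (key2 b a)]
  congr 2; ext x
  have hs : fderiv ℝ (fderiv ℝ g) x a b = fderiv ℝ (fderiv ℝ g) x b a :=
    (hg.contDiffAt.isSymmSndFDerivAt (by simp)) a b
  rw [hd, hd, hs, jdet]; ring

lemma jac_bound (a b : E2) (ha : ‖a‖ = 1) (hb : ‖b‖ = 1) (Ω : Set E2) (hΩ : MeasurableSet Ω)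
    (f g φ : E2 → ℝ) (N : E2 → ℝ) (hf : ContDiff ℝ 2 f) (hg : ContDiff ℝ 2 g)
    (hφ : ContDiff ℝ 1 φ) (hc : HasCompactSupport φ) (hsub : tsupport φ ⊆ Ω)
    (C ε : ℝ) (hC : ∀ x, ‖fderiv ℝ φ x‖ ≤ C) (hε : ∀ x ∈ Ω, |f x| ≤ ε) (hε0 : 0 ≤ ε)
    (hN : IntegrableOn N Ω) (hgN : ∀ x, ‖fderiv ℝ g x‖ ≤ N x) :
    |∫ x, jdet a b f g x * φ x| ≤ ε * (2 * C * ∫ x in Ω, N x) := by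
  rw [jac_parts a b f g φ hf hg hφ hc, abs_neg, ← integral_const_mul, ← integral_const_mul,
    ← setIntegral_eq_integral_of_forall_compl_eq_zero (s := Ω)]
  · rw [← Real.norm_eq_abs]
    apply norm_integral_le_of_norm_le ((hN.const_mul _).const_mul _)
    filter_upwards [ae_restrict_mem hΩ] with x hx
    have hC0 : 0 ≤ C := (norm_nonneg _).trans (hC x)
    have hb1 : ∀ c d : E2, ‖c‖ = 1 → ‖d‖ = 1 → |fderiv ℝ φ x c * fderiv ℝ g x d| ≤ C * N x := by
      intro c d hc hd
      rw [abs_mul]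
      have h1 := (fderiv ℝ φ x).le_opNorm c
      have h2 := (fderiv ℝ g x).le_opNorm d
      rw [hc, mul_one] at h1
      rw [hd, mul_one] at h2
      exact mul_le_mul (h1.trans (hC x)) (h2.trans (hgN x)) (abs_nonneg _) hC0
    rw [norm_mul]
    refine mul_le_mul (hε x hx) ?_ (norm_nonneg _) hε0
    calc ‖jdet a b φ g x‖ ≤ _ := norm_sub_le _ _
      _ ≤ C * N x + C * N x := add_le_add (hb1 a b ha hb) (hb1 b a hb ha)
      _ = _ := by ring
  · intro x hx
    have : fderiv ℝ φ x = 0 := by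
      by_contra h
      exact hx (hsub (support_fderiv_subset ℝ h))
    simp [jdet, this]

lemma comp_fderiv (w : E2 → E2) (hw : ContDiff ℝ 2 w) (i : Fin 2) (x c : E2) :
    fderiv ℝ (fun x => w x i) x c = fderiv ℝ w x c i := by
  have h : HasFDerivAt (fun x => w x i)
      ((EuclideanSpace.proj i : E2 →L[ℝ] ℝ).comp (fderiv ℝ w x)) x :=
    (EuclideanSpace.proj i : E2 →L[ℝ] ℝ).hasFDerivAt.comp x
      ((hw.differentiable (by norm_num)) x).hasFDerivAt
  rw [h.fderiv]; rfl

lemma comp_norm (w : E2 → E2) (hw : ContDiff ℝ 2 w) (i : Fin 2) (x : E2) :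
    ‖fderiv ℝ (fun x => w x i) x‖ ≤ ‖fderiv ℝ w x‖ := by
  refine ContinuousLinearMap.opNorm_le_bound _ (norm_nonneg _) fun c => ?_
  rw [comp_fderiv w hw]
  exact (PiLp.norm_apply_le _ i).trans ((fderiv ℝ w x).le_opNorm c)

lemma comp_smooth (w : E2 → E2) (hw : ContDiff ℝ 2 w) (i : Fin 2) :
    ContDiff ℝ 2 (fun x => w x i) :=
  (EuclideanSpace.proj i : E2 →L[ℝ] ℝ).contDiff.comp hw

lemma cont_intOn (Ω : Set E2) (hb : Bornology.IsBounded Ω) (N : E2 → ℝ) (hN : Continuous N) :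
    IntegrableOn N Ω :=
  (hN.continuousOn.integrableOn_compact hb.isCompact_closure).mono_set subset_closure

lemma det_conv (Ω : Set E2) (w : E2 → E2) (hw : ContDiff ℝ 2 w) (φ : E2 → ℝ)
    (hsub : tsupport φ ⊆ Ω) :
    ∫ x in Ω, (Matrix.of fun i j => fderiv ℝ w x (EuclideanSpace.single j 1) i).det * φ x
      = ∫ x, jdet (EuclideanSpace.single 0 1) (EuclideanSpace.single 1 1)
        (fun x => w x 0) (fun x => w x 1) x * φ x := by
  rw [setIntegral_eq_integral_of_forall_compl_eq_zero]
  · congr 1; ext x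
    simp only [jdet, comp_fderiv w hw, Matrix.det_fin_two, Matrix.of_apply]
  · intro x hx
    rw [image_eq_zero_of_notMem_tsupport (fun h => hx (hsub h)), mul_zero]

lemma jac_diff (a b : E2) (f₁ g₁ f g φ : E2 → ℝ) (hf₁ : ContDiff ℝ 2 f₁) (hg₁ : ContDiff ℝ 2 g₁)
    (hf : ContDiff ℝ 2 f) (hg : ContDiff ℝ 2 g)
    (hφ : ContDiff ℝ 1 φ) (hc : HasCompactSupport φ) :
    (∫ x, jdet a b f₁ g₁ x * φ x) - ∫ x, jdet a b f g x * φ x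
      = (∫ x, jdet a b (fun x => f₁ x - f x) g₁ x * φ x)
        - ∫ x, jdet a b (fun x => g₁ x - g x) f x * φ x := by
  have hi : ∀ f g : E2 → ℝ, ContDiff ℝ 2 f → ContDiff ℝ 2 g →
      Integrable (fun x => jdet a b f g x * φ x) := fun f g hf hg =>
    Continuous.integrable_of_hasCompactSupport
      ((jdet_cont a b (hf.of_le (by norm_num)) (hg.of_le (by norm_num))).mul hφ.continuous)
      hc.mul_left
  rw [← integral_sub (hi _ _ hf₁ hg₁) (hi _ _ hf hg),
    ← integral_sub (hi _ _ (hf₁.sub hf) hg₁) (hi _ _ (hg₁.sub hg) hf)]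
  congr 1; ext x
  have d : ∀ h : E2 → ℝ, ContDiff ℝ 2 h → DifferentiableAt ℝ h x := fun h hh =>
    hh.differentiable (by norm_num) x
  simp only [jdet]
  rw [fderiv_fun_sub (d _ hf₁) (d _ hf), fderiv_fun_sub (d _ hg₁) (d _ hg)]
  simp only [ContinuousLinearMap.sub_apply]
  ring

/-- weak convergence (3.4) of the `2×2` Jacobian determinants in the
proof of the paper's Proposition 3.1: if the Jacobians `Dw_k` are bounded in `L^p(Ω)`
(`p > 2`) and `w_k → w` uniformly on the bounded open set `Ω`, then
`∫_Ω det(Dw_k) φ dx → ∫_Ω det(Dw) φ dx` for every `C¹` test function `φ` with compact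
support in `Ω`. -/
theorem jacobian_determinants_weak_convergence
    (Ω : Set (EuclideanSpace ℝ (Fin 2))) (hΩopen : IsOpen Ω)
    (hΩbdd : Bornology.IsBounded Ω)
    (p : ℝ) (hp : 2 < p)
    (u : ℕ → EuclideanSpace ℝ (Fin 2) → EuclideanSpace ℝ (Fin 2))
    (v : EuclideanSpace ℝ (Fin 2) → EuclideanSpace ℝ (Fin 2))
    (hu : ∀ k, ContDiff ℝ 2 (u k)) (hv : ContDiff ℝ 2 v)
    (B : ℝ) (hbound : ∀ k, ∫ x in Ω, ‖fderiv ℝ (u k) x‖ ^ p ≤ B)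
    (hunif : TendstoUniformlyOn u v Filter.atTop Ω)
    (φ : EuclideanSpace ℝ (Fin 2) → ℝ)
    (hφ : ContDiffOn ℝ 1 φ Ω)
    (hsupp : IsCompact (tsupport φ)) (hsub : tsupport φ ⊆ Ω) :
    Filter.Tendsto
      (fun k => ∫ x in Ω,
        (Matrix.of fun i j => fderiv ℝ (u k) x (EuclideanSpace.single j 1) i).det * φ x)
      Filter.atTop
      (nhds (∫ x in Ω,
        (Matrix.of fun i j => fderiv ℝ v x (EuclideanSpace.single j 1) i).det * φ x)) := by
  have hφ' : ContDiff ℝ 1 φ := by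
    rw [contDiff_iff_contDiffAt]
    intro x
    by_cases hx : x ∈ tsupport φ
    · exact hφ.contDiffAt (hΩopen.mem_nhds (hsub hx))
    · have h0 : φ =ᶠ[nhds x] fun _ => 0 := notMem_tsupport_iff_eventuallyEq.1 hx
      exact contDiffAt_const.congr_of_eventuallyEq h0
  have hc : HasCompactSupport φ := hsupp
  obtain ⟨C, hC⟩ := (hc.fderiv ℝ).exists_bound_of_continuous (hφ'.continuous_fderiv (by norm_num))
  have hC0 : 0 ≤ C := (norm_nonneg _).trans (hC 0)
  simp only [fun k => det_conv Ω (u k) (hu k) φ hsub, det_conv Ω v hv φ hsub]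
  set a : EuclideanSpace ℝ (Fin 2) := EuclideanSpace.single 0 1 with ha'
  set b : EuclideanSpace ℝ (Fin 2) := EuclideanSpace.single 1 1 with hb'
  have ha : ‖a‖ = 1 := by simp [ha']
  have hb : ‖b‖ = 1 := by simp [hb']
  have hucont : ∀ k, Continuous fun x => ‖fderiv ℝ (u k) x‖ := fun k =>
    ((hu k).continuous_fderiv (by norm_num)).norm
  have hvcont : Continuous fun x => ‖fderiv ℝ v x‖ := (hv.continuous_fderiv (by norm_num)).norm
  have hNu : ∀ k, IntegrableOn (fun x => ‖fderiv ℝ (u k) x‖) Ω := fun k =>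
    cont_intOn Ω hΩbdd _ (hucont k)
  have hNv : IntegrableOn (fun x => ‖fderiv ℝ v x‖) Ω := cont_intOn Ω hΩbdd _ hvcont
  have hNp : ∀ k, IntegrableOn (fun x => ‖fderiv ℝ (u k) x‖ ^ p) Ω := fun k =>
    cont_intOn Ω hΩbdd _ ((hucont k).rpow_const fun _ => Or.inr (by linarith))
  have h1i : IntegrableOn (fun _ => (1 : ℝ)) Ω := cont_intOn Ω hΩbdd _ continuous_const
  set V : ℝ := ∫ x in Ω, (1 : ℝ) with hV
  have hM : ∀ k, ∫ x in Ω, ‖fderiv ℝ (u k) x‖ ≤ V + B := by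
    intro k
    calc ∫ x in Ω, ‖fderiv ℝ (u k) x‖ ≤ ∫ x in Ω, (1 + ‖fderiv ℝ (u k) x‖ ^ p) := by
          refine integral_mono (hNu k) (h1i.add (hNp k)) fun x => ?_
          show ‖fderiv ℝ (u k) x‖ ≤ 1 + ‖fderiv ℝ (u k) x‖ ^ p
          have hn := norm_nonneg (fderiv ℝ (u k) x)
          rcases le_total (‖fderiv ℝ (u k) x‖) 1 with h | h
          · have := Real.rpow_nonneg hn p
            linarith
          · have := Real.self_le_rpow_of_one_le h (by linarith : 1 ≤ p)
            linarith
      _ = V + ∫ x in Ω, ‖fderiv ℝ (u k) x‖ ^ p := integral_add h1i (hNp k)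
      _ ≤ V + B := by linarith [hbound k]
  have hVB : 0 ≤ V + B := (integral_nonneg fun _ => norm_nonneg _).trans (hM 0)
  set W : ℝ := ∫ x in Ω, ‖fderiv ℝ v x‖ with hW
  have hW0 : 0 ≤ W := integral_nonneg fun _ => norm_nonneg _
  set K : ℝ := 2 * C * (V + B) + 2 * C * W with hK
  have hK0 : 0 ≤ K := by positivity
  rw [Metric.tendsto_nhds]
  intro δ hδ
  have hε : 0 < δ / (K + 1) := by positivity
  set ε := δ / (K + 1) with hεd
  filter_upwards [Metric.tendstoUniformlyOn_iff.1 hunif ε hε] with k hk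
  have hcomp : ∀ i : Fin 2, ∀ x ∈ Ω, |u k x i - v x i| ≤ ε := by
    intro i x hx
    have h1 := hk x hx
    rw [dist_comm, dist_eq_norm] at h1
    exact (PiLp.norm_apply_le (u k x - v x) i).trans h1.le
  rw [Real.dist_eq, jac_diff a b _ _ _ _ φ (comp_smooth _ (hu k) 0) (comp_smooth _ (hu k) 1)
    (comp_smooth _ hv 0) (comp_smooth _ hv 1) hφ' hc]
  have b1 := jac_bound a b ha hb Ω hΩopen.measurableSet (fun x => u k x 0 - v x 0)
    (fun x => u k x 1) φ _ ((comp_smooth _ (hu k) 0).sub (comp_smooth _ hv 0))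
    (comp_smooth _ (hu k) 1) hφ' hc hsub C ε hC (hcomp 0) hε.le (hNu k) (comp_norm _ (hu k) 1)
  have b2 := jac_bound a b ha hb Ω hΩopen.measurableSet (fun x => u k x 1 - v x 1)
    (fun x => v x 0) φ _ ((comp_smooth _ (hu k) 1).sub (comp_smooth _ hv 1))
    (comp_smooth _ hv 0) hφ' hc hsub C ε hC (hcomp 1) hε.le hNv (comp_norm _ hv 0)
  have b3 : ε * (2 * C * ∫ x in Ω, ‖fderiv ℝ (u k) x‖) ≤ ε * (2 * C * (V + B)) := by
    have := hM k
    gcongr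
  rw [← Real.norm_eq_abs] at b1 b2 ⊢
  calc _ ≤ _ := norm_sub_le _ _
    _ ≤ ε * (2 * C * (V + B)) + ε * (2 * C * W) := add_le_add (b1.trans b3) b2
    _ = ε * K := by rw [hK]; ring
    _ < ε * (K + 1) := by linarith
    _ = δ := by rw [hεd]; field_simp
end
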